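/- Let r ≥ 1 and positive integers m_1,…,m_r be fixed, n = m_1+⋯+m_r, with the canonical block structure constants c and unit vector e. Let Ω ⊆ ℝⁿ be open, let Γ^i_{jk} : Ω → ℝ be smooth functions symmetric in the lower indices with Σ_k Γ^i_{jk} e^k = 0 on Ω, and let X, Y : Ω → ℝⁿ be smooth maps satisfying, for all i,j,k and every point of Ω, Σ_s c^i_{js}(∂_k X^s + Σ_t Γ^s_{kt} X^t) = Σ_s c^i_{ks}(∂_j X^s + Σ_t Γ^s_{jt} X^t), and the same identity with X replaced by Y. If (x,t) ∈ ℝ² and p ∈ Ω satisfy the hodograph relation x·e^i + t·X^i(p) = Y^i(p) for all i, then the n×n matrix M with entries M^i_j = t·∂_j X^i(p) − ∂_j Y^i(p) is block-diagonal lower-triangular Toeplitz: M^{i(α)}_{j(β)} = 0 for α ≠ β, M^{i(α)}_{j(α)} = 0 for i < j, and M^{i(α)}_{j(α)} = M^{(i−j+1)(α)}_{1(α)} for i ≥ j. -/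

import Mathlib

/-- Double index: block `α ∈ {1,…,r}` and (0-based) position inside the block. -/
abbrev BIdx {r : ℕ} (m : Fin r → ℕ) : Type := (α : Fin r) × Fin (m α)

/-- Canonical block structure constants: `c^{i(α)}_{j(β)k(γ)} = δ^α_β δ^α_γ δ^i_{j+k−1}`
(in 0-based positions: equal to `1` iff all three indices lie in the same block and
`i = j + k`). -/
noncomputable def cBlock {r : ℕ} (m : Fin r → ℕ) (i j k : BIdx m) : ℝ :=
  if i.1 = j.1 ∧ i.1 = k.1 ∧ (i.2 : ℕ) = (j.2 : ℕ) + (k.2 : ℕ) then 1 else 0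

/-- Unit vector: `e^{i(α)} = δ^i_1`. -/
noncomputable def eBlock {r : ℕ} (m : Fin r → ℕ) (i : BIdx m) : ℝ :=
  if (i.2 : ℕ) = 0 then 1 else 0

/-- Partial derivative of a scalar function on `ℝⁿ` in the `j`-th coordinate direction. -/
noncomputable def pd {ι : Type*} [Fintype ι] [DecidableEq ι]
    (f : (ι → ℝ) → ℝ) (j : ι) (p : ι → ℝ) : ℝ :=
  fderiv ℝ f p (Pi.single j 1)

theorem sum_cBlock_mul_eq_zero {r : ℕ} {m : Fin r → ℕ} {i j : BIdx m}
    (h : ¬ (i.1 = j.1 ∧ (j.2 : ℕ) ≤ (i.2 : ℕ))) (V : BIdx m → ℝ) :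
    ∑ s, cBlock m i j s * V s = 0 := by
  refine Finset.sum_eq_zero fun s _ => ?_
  rw [cBlock, if_neg, zero_mul]
  rintro ⟨h₁, -, h₂⟩
  exact h ⟨h₁, by omega⟩

theorem sum_cBlock_mul {r : ℕ} {m : Fin r → ℕ} {α : Fin r} {i j : Fin (m α)}
    (h : (j : ℕ) ≤ (i : ℕ)) (V : BIdx m → ℝ) :
    ∑ s, cBlock m ⟨α, i⟩ ⟨α, j⟩ s * V s
      = V ⟨α, ⟨(i : ℕ) - (j : ℕ), lt_of_le_of_lt (Nat.sub_le _ _) i.isLt⟩⟩ := by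
  rw [Finset.sum_eq_single ⟨α, ⟨(i : ℕ) - (j : ℕ), lt_of_le_of_lt (Nat.sub_le _ _) i.isLt⟩⟩]
  · rw [cBlock, if_pos, one_mul]
    exact ⟨rfl, rfl, by dsimp only; omega⟩
  · rintro ⟨β, s⟩ - hs
    rw [cBlock, if_neg, zero_mul]
    rintro ⟨-, h₁, h₂⟩
    dsimp only at h₁ h₂
    subst h₁
    apply hs
    congr 1
    ext
    dsimp only
    omega
  · simp

theorem cBlock_swap {r : ℕ} (m : Fin r → ℕ) (i j k : BIdx m) :
    cBlock m i j k = cBlock m i k j := by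
  simp only [cBlock]
  congr 1
  rw [add_comm (j.2 : ℕ)]
  exact propext and_left_comm

/-- The vector `e` is the unit of the product with structure constants `c`. -/
theorem sum_cBlock_mul_eBlock {r : ℕ} (m : Fin r → ℕ) (i s : BIdx m) :
    ∑ k, cBlock m i k s * eBlock m k = if i = s then 1 else 0 := by
  simp_rw [cBlock_swap m i _ s]
  by_cases h : i.1 = s.1 ∧ (s.2 : ℕ) ≤ (i.2 : ℕ)
  · obtain ⟨α, i⟩ := i
    obtain ⟨β, s⟩ := s
    obtain ⟨h₁, h₂⟩ := h
    dsimp only at h₁ h₂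
    subst h₁
    rw [sum_cBlock_mul h₂, eBlock]
    congr 1
    simp only [Sigma.mk.injEq, heq_eq_eq, true_and, Fin.ext_iff, eq_iff_iff]
    omega
  · rw [sum_cBlock_mul_eq_zero h, if_neg]
    rintro rfl
    exact h ⟨rfl, le_rfl⟩

/-- If `c^i_{js} M^s_k` is symmetric in `j, k`, then `M` is multiplication by `M e`. -/
theorem eq_sum_cBlock_mul_of_symm {r : ℕ} {m : Fin r → ℕ} {M : BIdx m → BIdx m → ℝ}
    (h : ∀ i j k, ∑ s, cBlock m i j s * M s k = ∑ s, cBlock m i k s * M s j) (i j : BIdx m) :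
    M i j = ∑ s, cBlock m i j s * ∑ k, M s k * eBlock m k := by
  calc M i j = ∑ s, (∑ k, cBlock m i k s * eBlock m k) * M s j := by
        simp [sum_cBlock_mul_eBlock]
    _ = ∑ k, (∑ s, cBlock m i k s * M s j) * eBlock m k := by
        simp_rw [Finset.sum_mul]
        rw [Finset.sum_comm]
        exact Finset.sum_congr rfl fun _ _ => Finset.sum_congr rfl fun _ _ => by ring
    _ = ∑ k, (∑ s, cBlock m i j s * M s k) * eBlock m k := by simp_rw [← h i j]
    _ = ∑ s, cBlock m i j s * ∑ k, M s k * eBlock m k := by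
        simp_rw [Finset.sum_mul, Finset.mul_sum]
        rw [Finset.sum_comm]
        exact Finset.sum_congr rfl fun _ _ => Finset.sum_congr rfl fun _ _ => by ring

/-- on a solution `p` of the hodograph relation `x·e + t·X(p) = Y(p)`, the
matrix `M^i_j = t·∂_j X^i(p) − ∂_j Y^i(p)` is block-diagonal lower-triangular Toeplitz. -/
theorem hodograph_matrix_is_block_toeplitz
    (r : ℕ) (hr : 1 ≤ r) (m : Fin r → ℕ) (hm : ∀ α, 0 < m α)
    (Ω : Set (BIdx m → ℝ)) (hΩ : IsOpen Ω)
    (Γ : BIdx m → BIdx m → BIdx m → (BIdx m → ℝ) → ℝ)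
    (hΓsmooth : ∀ i j k, ContDiffOn ℝ (⊤ : ℕ∞) (Γ i j k) Ω)
    (hΓsym : ∀ i j k, ∀ p ∈ Ω, Γ i j k p = Γ i k j p)
    (hΓe : ∀ i j, ∀ p ∈ Ω, ∑ k, Γ i j k p * eBlock m k = 0)
    (X Y : (BIdx m → ℝ) → (BIdx m → ℝ))
    (hXsmooth : ContDiffOn ℝ (⊤ : ℕ∞) X Ω) (hYsmooth : ContDiffOn ℝ (⊤ : ℕ∞) Y Ω)
    (hdX : ∀ i j k, ∀ p ∈ Ω,
      ∑ s, cBlock m i j s * (pd (fun u => X u s) k p + ∑ t', Γ s k t' p * X p t')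
        = ∑ s, cBlock m i k s * (pd (fun u => X u s) j p + ∑ t', Γ s j t' p * X p t'))
    (hdY : ∀ i j k, ∀ p ∈ Ω,
      ∑ s, cBlock m i j s * (pd (fun u => Y u s) k p + ∑ t', Γ s k t' p * Y p t')
        = ∑ s, cBlock m i k s * (pd (fun u => Y u s) j p + ∑ t', Γ s j t' p * Y p t'))
    (x t : ℝ) (p : BIdx m → ℝ) (hp : p ∈ Ω)
    (hhodo : ∀ i, x * eBlock m i + t * X p i = Y p i)
    (M : BIdx m → BIdx m → ℝ)
    (hMdef : ∀ i j, M i j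
      = t * pd (fun u => X u i) j p - pd (fun u => Y u i) j p) :
    (∀ (α β : Fin r) (i : Fin (m α)) (j : Fin (m β)), α ≠ β → M ⟨α, i⟩ ⟨β, j⟩ = 0) ∧
    (∀ (α : Fin r) (i j : Fin (m α)), (i : ℕ) < (j : ℕ) → M ⟨α, i⟩ ⟨α, j⟩ = 0) ∧
    (∀ (α : Fin r) (i j : Fin (m α)), (j : ℕ) ≤ (i : ℕ) →
      M ⟨α, i⟩ ⟨α, j⟩
        = M ⟨α, ⟨(i : ℕ) - (j : ℕ), lt_of_le_of_lt (Nat.sub_le _ _) i.isLt⟩⟩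
            ⟨α, ⟨0, Nat.lt_of_le_of_lt (Nat.zero_le _) i.isLt⟩⟩) := by
  have hΓ : ∀ s k, t * ∑ t', Γ s k t' p * X p t' = ∑ t', Γ s k t' p * Y p t' := by
    intro s k
    have h : ∑ t', Γ s k t' p * Y p t'
        = x * ∑ t', Γ s k t' p * eBlock m t' + t * ∑ t', Γ s k t' p * X p t' := by
      rw [Finset.mul_sum, Finset.mul_sum, ← Finset.sum_add_distrib]
      exact Finset.sum_congr rfl fun t' _ => by rw [← hhodo t']; ring
    rw [h, hΓe s k p hp, mul_zero, zero_add]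
  have hM : ∀ s k, M s k
      = t * (pd (fun u => X u s) k p + ∑ t', Γ s k t' p * X p t')
        - (pd (fun u => Y u s) k p + ∑ t', Γ s k t' p * Y p t') := by
    intro s k
    rw [hMdef, ← hΓ s k]
    ring
  have hsymm : ∀ i j k, ∑ s, cBlock m i j s * M s k = ∑ s, cBlock m i k s * M s j := by
    intro i j k
    simp_rw [hM, mul_sub, mul_left_comm _ t, Finset.sum_sub_distrib, ← Finset.mul_sum]
    rw [hdX i j k p hp, hdY i j k p hp]
  have key := eq_sum_cBlock_mul_of_symm hsymm
  refine ⟨fun α β i j hαβ => ?_, fun α i j hij => ?_, fun α i j hij => ?_⟩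
  · rw [key]
    exact sum_cBlock_mul_eq_zero (fun h => hαβ h.1) _
  · rw [key]
    exact sum_cBlock_mul_eq_zero (fun h => hij.not_ge h.2) _
  · rw [key, key ⟨α, ⟨(i : ℕ) - (j : ℕ), _⟩⟩, sum_cBlock_mul hij,
      sum_cBlock_mul (Nat.zero_le _)]
    rfl
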